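/- Promising graph, type 6: Suppose that in a play of the (K^{ℵ0}, K^4)-building game it is the first player's turn, and there are seven distinct vertices a, b, c, d, e, f, g such that the edges ab, ac, ad, ae, af, ag, bc are red, the edges bd, be, bf, cd, ce are blue, and all other edges among {a, b, c, d, e, f, g} are unclaimed (in particular the vulnerable edges bg, cf, ef are unclaimed). Suppose further that on the whole board, even after adding bg, cf and ef as blue edges, the blue edges contain no K^4 and admit no blue threat. Then the first player has a winning strategy from this position: each of her moves before the last creates a red threat, and she completes a red K^4 within at most 5 further moves of hers (she begins by claiming cg, and if the second player answers bg, the induced position on {a, c, d, e, f, g} is a realised promising graph of type 3). -/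

import Mathlib

/-!
Positions in the `(K^{ℵ₀}, K^4)`-building game.  A position is a pair `(R, B)`
of disjoint finite sets of red (first player's) and blue (second player's)
edges of the complete graph on `ℕ`; an edge is unclaimed if it lies in neither
set.
-/

/-- A history of further moves played from a position, in chronological order;
the player to move plays at even indices, the other player at odd indices. -/
abbrev Hist : Type := List (Sym2 ℕ)

/-- A strategy: assigns to each sequence of previously claimed edges an edge. -/
abbrev Strategy : Type := Hist → Sym2 ℕ

/-- The edges claimed at even indices of a history. -/
def firstPlayerEdges (h : Hist) : Set (Sym2 ℕ) :=
  {x | ∃ i : Fin h.length, (i : ℕ) % 2 = 0 ∧ h.get i = x}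

/-- The edges claimed at odd indices of a history. -/
def secondPlayerEdges (h : Hist) : Set (Sym2 ℕ) :=
  {x | ∃ i : Fin h.length, (i : ℕ) % 2 = 1 ∧ h.get i = x}

/-- The red edges after the further moves `h` have been played from a position
with red edges `R`, the first player (red) moving at even indices. -/
def redAfter (R : Finset (Sym2 ℕ)) (h : Hist) : Set (Sym2 ℕ) :=
  ↑R ∪ firstPlayerEdges h

/-- The blue edges after the further moves `h` have been played from a
position with blue edges `B`, the second player (blue) moving at odd
indices. -/
def blueAfter (B : Finset (Sym2 ℕ)) (h : Hist) : Set (Sym2 ℕ) :=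
  ↑B ∪ secondPlayerEdges h

/-- An edge is a legal move if it is a proper edge (not a loop) and is
unclaimed, i.e. lies neither in the position `(R, B)` nor in the history `h`
of further moves. -/
def LegalFrom (R B : Finset (Sym2 ℕ)) (h : Hist) (x : Sym2 ℕ) : Prop :=
  ¬ x.IsDiag ∧ x ∉ R ∧ x ∉ B ∧ x ∉ h

/-- The history of further moves after `n` moves, when the player to move
follows the strategy `σ` and the other player follows the strategy `τ`. -/
def play (σ τ : Strategy) : ℕ → Hist
  | 0 => []
  | n + 1 => play σ τ n ++ [if n % 2 = 0 then σ (play σ τ n) else τ (play σ τ n)]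

/-- `E` contains all six edges on some 4-element vertex set. -/
def HasK4 (E : Set (Sym2 ℕ)) : Prop :=
  ∃ t : Finset ℕ, t.card = 4 ∧ ∀ u ∈ t, ∀ v ∈ t, u ≠ v → s(u, v) ∈ E

/-- A threat for the colour with edge set `C`, the other colour having edge
set `O`: a 4-element vertex set `t` on which the edge `x` is unclaimed while
all five other edges belong to `C`. -/
def IsThreat (C O : Set (Sym2 ℕ)) (t : Finset ℕ) (x : Sym2 ℕ) : Prop :=
  t.card = 4 ∧ (∃ u ∈ t, ∃ v ∈ t, u ≠ v ∧ x = s(u, v)) ∧ x ∉ C ∧ x ∉ O ∧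
    ∀ u ∈ t, ∀ v ∈ t, u ≠ v → s(u, v) ≠ x → s(u, v) ∈ C

/-- The colour with edge set `C` admits a threat (the other colour having edge
set `O`). -/
def HasThreat (C O : Set (Sym2 ℕ)) : Prop := ∃ t x, IsThreat C O t x

/-- From the position `(R, B)` with the first player (red) to move, the first
player has a winning strategy which completes a red `K^4` within at most
`(bound + 1) / 2` further moves of hers, each of her moves before the last
creating a red threat: against every legally playing opponent there is an odd
stage `n ≤ bound` (a stage just after one of her own moves, her `r`-th further
move being move number `2 * r - 1`) at which, all of her moves having been
legal and each of her moves before the last having created a red threat, the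
red edges contain a `K^4` while the blue edges do not. -/
def WinsFromWithinThreats (R B : Finset (Sym2 ℕ)) (bound : ℕ) : Prop :=
  ∃ σ : Strategy, ∀ τ : Strategy,
    (∀ n, n % 2 = 1 → (∃ x, LegalFrom R B (play σ τ n) x) →
      LegalFrom R B (play σ τ n) (τ (play σ τ n))) →
    ∃ n ≤ bound, n % 2 = 1 ∧
      (∀ m < n, m % 2 = 0 → LegalFrom R B (play σ τ m) (σ (play σ τ m))) ∧
      (∀ m, m % 2 = 0 → m + 1 < n →
        HasThreat (redAfter R (play σ τ (m + 1)))
          (blueAfter B (play σ τ (m + 1)))) ∧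
      HasK4 (redAfter R (play σ τ n)) ∧ ¬ HasK4 (blueAfter B (play σ τ n))

theorem firstPlayerEdges_nil : firstPlayerEdges [] = ∅ := by
  ext z
  simp [firstPlayerEdges]

theorem secondPlayerEdges_nil : secondPlayerEdges [] = ∅ := by
  ext z
  simp [secondPlayerEdges]

theorem firstPlayerEdges_cons (x : Sym2 ℕ) (h : Hist) :
    firstPlayerEdges (x :: h) = insert x (secondPlayerEdges h) := by
  ext z
  simp only [firstPlayerEdges, secondPlayerEdges, Set.mem_ofPred_eq, Set.mem_insert_iff]
  constructor
  · rintro ⟨⟨_ | i, hi⟩, hpar, rfl⟩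
    · exact Or.inl rfl
    · exact Or.inr ⟨⟨i, by simpa using hi⟩, by dsimp only at hpar ⊢; omega, rfl⟩
  · rintro (rfl | ⟨⟨i, hi⟩, hpar, rfl⟩)
    · exact ⟨⟨0, by simp⟩, rfl, rfl⟩
    · exact ⟨⟨i + 1, by simpa using hi⟩, by dsimp only at hpar ⊢; omega, rfl⟩

theorem secondPlayerEdges_cons (x : Sym2 ℕ) (h : Hist) :
    secondPlayerEdges (x :: h) = firstPlayerEdges h := by
  ext z
  simp only [firstPlayerEdges, secondPlayerEdges, Set.mem_ofPred_eq]
  constructor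
  · rintro ⟨⟨_ | i, hi⟩, hpar, rfl⟩
    · simp at hpar
    · exact ⟨⟨i, by simpa using hi⟩, by dsimp only at hpar ⊢; omega, rfl⟩
  · rintro ⟨⟨i, hi⟩, hpar, rfl⟩
    exact ⟨⟨i + 1, by simpa using hi⟩, by dsimp only at hpar ⊢; omega, rfl⟩

theorem redAfter_cons_cons (R : Finset (Sym2 ℕ)) (x y : Sym2 ℕ) (h : Hist) :
    redAfter R (x :: y :: h) = redAfter (insert x R) h := by
  simp [redAfter, firstPlayerEdges_cons, secondPlayerEdges_cons, Set.insert_union]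

theorem blueAfter_cons_cons (B : Finset (Sym2 ℕ)) (x y : Sym2 ℕ) (h : Hist) :
    blueAfter B (x :: y :: h) = blueAfter (insert y B) h := by
  simp [blueAfter, firstPlayerEdges_cons, secondPlayerEdges_cons, Set.insert_union]

theorem redAfter_singleton (R : Finset (Sym2 ℕ)) (x : Sym2 ℕ) :
    redAfter R [x] = ↑(insert x R) := by
  simp [redAfter, firstPlayerEdges_cons, secondPlayerEdges_nil]

theorem blueAfter_singleton (B : Finset (Sym2 ℕ)) (x : Sym2 ℕ) : blueAfter B [x] = ↑B := by
  simp [blueAfter, secondPlayerEdges_cons, firstPlayerEdges_nil]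

theorem legalFrom_cons_cons {R B : Finset (Sym2 ℕ)} {x y z : Sym2 ℕ} {h : Hist} :
    LegalFrom R B (x :: y :: h) z ↔ LegalFrom (insert x R) (insert y B) h z := by
  simp only [LegalFrom, Finset.mem_insert, List.mem_cons]
  tauto

/-- The play after the first two moves is the play of the strategies following these moves. -/
theorem play_add_two {σ τ : Strategy} {x y : Sym2 ℕ} (hx : σ [] = x) (hy : τ [x] = y) (n : ℕ) :
    play σ τ (n + 2) =
      x :: y :: play (fun h => σ (x :: y :: h)) (fun h => τ (x :: y :: h)) n := by
  induction n with
  | zero => simp [play, hx, hy]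
  | succ n ih => rw [play, ih, play]; simp

/-- Completing a red `K^4` at once. -/
theorem winsFromWithinThreats_of_hasK4 {R B : Finset (Sym2 ℕ)} {x : Sym2 ℕ} {k : ℕ}
    (hk : 1 ≤ k) (hx : LegalFrom R B [] x) (hR : HasK4 ↑(insert x R)) (hB : ¬ HasK4 ↑B) :
    WinsFromWithinThreats R B k := by
  refine ⟨fun _ => x, fun τ _ => ⟨1, hk, rfl, ?_, ?_, ?_, ?_⟩⟩
  · intro m hm _
    obtain rfl : m = 0 := by omega
    exact hx
  · intro m _ hm
    omega
  · simpa [play, redAfter_singleton] using hR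
  · simpa [play, blueAfter_singleton] using hB

/-- Making a threat with `x` such that every answer leads to a won position. -/
theorem winsFromWithinThreats_of_forall_reply {R B : Finset (Sym2 ℕ)} {x : Sym2 ℕ} {k : ℕ}
    (hx : LegalFrom R B [] x) (hthreat : HasThreat ↑(insert x R) ↑B)
    (hreply : ∀ y, LegalFrom (insert x R) B [] y →
      WinsFromWithinThreats (insert x R) (insert y B) k) :
    WinsFromWithinThreats R B (k + 2) := by
  have hopen : ∃ z, LegalFrom R B [x] z := by
    obtain ⟨t, z, -, ⟨u, -, v, -, huv, rfl⟩, hzR, hzB, -⟩ := hthreat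
    have hz : s(u, v) ≠ x ∧ s(u, v) ∉ R := by simpa using hzR
    exact ⟨s(u, v), by simpa using huv, hz.2, by simpa using hzB, by simpa using hz.1⟩
  have hchoice : ∀ y, ∃ σ : Strategy, LegalFrom (insert x R) B [] y → ∀ τ : Strategy,
      (∀ n, n % 2 = 1 → (∃ z, LegalFrom (insert x R) (insert y B) (play σ τ n) z) →
        LegalFrom (insert x R) (insert y B) (play σ τ n) (τ (play σ τ n))) →
      ∃ n ≤ k, n % 2 = 1 ∧
        (∀ m < n, m % 2 = 0 →
          LegalFrom (insert x R) (insert y B) (play σ τ m) (σ (play σ τ m))) ∧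
        (∀ m, m % 2 = 0 → m + 1 < n →
          HasThreat (redAfter (insert x R) (play σ τ (m + 1)))
            (blueAfter (insert y B) (play σ τ (m + 1)))) ∧
        HasK4 (redAfter (insert x R) (play σ τ n)) ∧
        ¬ HasK4 (blueAfter (insert y B) (play σ τ n)) := by
    intro y
    by_cases hy : LegalFrom (insert x R) B [] y
    · obtain ⟨σ, hσ⟩ := hreply y hy
      exact ⟨σ, fun _ => hσ⟩
    · exact ⟨fun _ => x, fun h => absurd h hy⟩
  choose σ hσ using hchoice
  let ρ : Strategy := fun h => match h with
    | _ :: y :: h => σ y h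
    | _ => x
  refine ⟨ρ, fun τ hτ => ?_⟩
  have play_one : play ρ τ 1 = [x] := by simp [play, ρ]
  have hplay : ∀ n, play ρ τ (n + 2) =
      x :: τ [x] :: play (σ (τ [x])) (fun h => τ (x :: τ [x] :: h)) n :=
    play_add_two (σ := ρ) rfl rfl
  have hlegal : LegalFrom (insert x R) B [] (τ [x]) := by
    have h := hτ 1 rfl (by simpa only [play_one] using hopen)
    rw [play_one] at h
    simpa [LegalFrom, and_assoc, and_left_comm, and_comm] using h
  obtain ⟨n, hnk, hn, hmoves, hthreats, hred, hblue⟩ :=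
    hσ (τ [x]) hlegal (fun h => τ (x :: τ [x] :: h)) (by
      intro n hn hex
      have h := hτ (n + 2) (by omega)
      simp only [hplay, legalFrom_cons_cons] at h
      exact h hex)
  refine ⟨n + 2, by omega, by omega, ?_, ?_, ?_, ?_⟩
  · rintro (_ | _ | m) hm hpar
    · exact hx
    · omega
    · rw [hplay, legalFrom_cons_cons]
      exact hmoves m (by omega) (by omega)
  · rintro (_ | _ | m) hpar hm
    · simpa only [zero_add, play_one, redAfter_singleton, blueAfter_singleton] using hthreat
    · omega
    · rw [show m + 1 + 1 + 1 = (m + 1) + 2 from rfl, hplay, redAfter_cons_cons,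
        blueAfter_cons_cons]
      exact hthreats m (by omega) (by omega)
  · rwa [hplay, redAfter_cons_cons]
  · rwa [hplay, blueAfter_cons_cons]

/-- Claiming the open edge of a threat completes a `K^4`. -/
theorem IsThreat.hasK4_insert {C O : Set (Sym2 ℕ)} {t : Finset ℕ} {z : Sym2 ℕ}
    (h : IsThreat C O t z) : HasK4 (insert z C) := by
  obtain ⟨hcard, -, -, -, hC⟩ := h
  refine ⟨t, hcard, fun u hu v hv huv => ?_⟩
  by_cases hz : s(u, v) = z
  · exact Or.inl hz
  · exact Or.inr (hC u hu v hv huv hz)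

/-- A red threat that is not answered by claiming its open edge wins. -/
theorem IsThreat.winsFromWithinThreats {R B : Finset (Sym2 ℕ)} {t : Finset ℕ} {y z : Sym2 ℕ}
    {k : ℕ} (h : IsThreat ↑R ↑B t z) (hk : 1 ≤ k) (hzy : z ≠ y)
    (hB : ¬ HasK4 ↑(insert y B)) : WinsFromWithinThreats R (insert y B) k := by
  refine winsFromWithinThreats_of_hasK4 hk ?_ (by simpa using h.hasK4_insert) hB
  obtain ⟨-, ⟨u, -, v, -, huv, rfl⟩, hzR, hzB, -⟩ := h
  exact ⟨by simpa using huv, by simpa using hzR, by simpa [hzy] using hzB, by simp⟩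

/-- If claiming `x` makes a threat with open edge `z`, and blue cannot complete a `K^4` in one move,
it is enough to consider the answer `z`. -/
theorem winsFromWithinThreats_of_isThreat {R B : Finset (Sym2 ℕ)} {t : Finset ℕ} {x z : Sym2 ℕ}
    {k : ℕ} (hk : 1 ≤ k) (hx : LegalFrom R B [] x) (hz : IsThreat ↑(insert x R) ↑B t z)
    (hsafe : ∀ y ∉ R, ¬ HasK4 ↑(insert y B))
    (hnext : WinsFromWithinThreats (insert x R) (insert z B) k) :
    WinsFromWithinThreats R B (k + 2) := by
  refine winsFromWithinThreats_of_forall_reply hx ⟨t, z, hz⟩ fun y hy => ?_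
  by_cases hzy : z = y
  · exact hzy ▸ hnext
  · exact hz.winsFromWithinThreats hk hzy (hsafe y fun h => hy.2.1 (Finset.mem_insert_of_mem h))

/-- Making two threats at once wins if blue cannot complete a `K^4` in one move. -/
theorem winsFromWithinThreats_of_isThreat_of_isThreat {R B : Finset (Sym2 ℕ)} {t t' : Finset ℕ}
    {x z z' : Sym2 ℕ} (hx : LegalFrom R B [] x) (hz : IsThreat ↑(insert x R) ↑B t z)
    (hz' : IsThreat ↑(insert x R) ↑B t' z') (hne : z' ≠ z)
    (hsafe : ∀ y ∉ R, ¬ HasK4 ↑(insert y B)) : WinsFromWithinThreats R B 3 := by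
  refine winsFromWithinThreats_of_isThreat le_rfl hx hz hsafe
    (hz'.winsFromWithinThreats le_rfl hne (hsafe z fun h => hz.2.2.1 ?_))
  exact Finset.mem_coe.mpr (Finset.mem_insert_of_mem h)

/-- A colour class with neither a `K^4` nor a threat has no `K^4` after claiming one more edge. -/
theorem not_hasK4_of_subset_insert {C O E : Set (Sym2 ℕ)} {x : Sym2 ℕ}
    (hK : ¬ HasK4 C) (hT : ¬ HasThreat C O) (hx : x ∉ O) (hE : E ⊆ insert x C) :
    ¬ HasK4 E := by
  rintro ⟨t, ht, h⟩
  by_cases hxt : x ∉ C ∧ ∃ u ∈ t, ∃ v ∈ t, u ≠ v ∧ x = s(u, v)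
  · refine hT ⟨t, x, ht, hxt.2, hxt.1, hx, fun u hu v hv huv hne => ?_⟩
    exact (hE (h u hu v hv huv)).resolve_left hne
  · refine hK ⟨t, ht, fun u hu v hv huv => ?_⟩
    rcases hE (h u hu v hv huv) with heq | hmem
    · by_contra hC
      exact hxt ⟨heq ▸ hC, u, hu, v, hv, huv, heq.symm⟩
    · exact hmem

/-- Five edges on `p, q, r, s` together with the unclaimed edge `rs` form a threat. -/
theorem isThreat_of_edges {C O : Set (Sym2 ℕ)} {p q r s : ℕ}
    (hcard : ({p, q, r, s} : Finset ℕ).card = 4)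
    (hpq : s(p, q) ∈ C) (hpr : s(p, r) ∈ C) (hps : s(p, s) ∈ C)
    (hqr : s(q, r) ∈ C) (hqs : s(q, s) ∈ C) (hrs : r ≠ s)
    (hC : s(r, s) ∉ C) (hO : s(r, s) ∉ O) : IsThreat C O {p, q, r, s} s(r, s) := by
  refine ⟨hcard, ⟨r, by simp, s, by simp, hrs, rfl⟩, hC, hO, ?_⟩
  intro u hu v hv huv hne
  simp only [Finset.mem_insert, Finset.mem_singleton] at hu hv
  rcases hu with rfl | rfl | rfl | rfl <;> rcases hv with rfl | rfl | rfl | rfl <;>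
    first
      | exact absurd rfl huv
      | exact absurd rfl hne
      | exact absurd Sym2.eq_swap hne
      | assumption
      | (rw [Sym2.eq_swap]; assumption)

/-- Promising graph of type 6.  Suppose that in a play of the
`(K^{ℵ₀}, K^4)`-building game it is the first player's turn and there are
seven distinct vertices `a, b, c, d, e, f, g` such that the edges
`ab, ac, ad, ae, af, ag, bc` are red, the edges `bd, be, bf, cd, ce` are blue,
and all other edges among `{a, b, c, d, e, f, g}` (namely
`bg, cf, cg, de, df, dg, ef, eg, fg`, in particular the vulnerable edges
`bg, cf, ef`) are unclaimed.  Suppose further that on the whole board, even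
after adding `bg`, `cf` and `ef` as blue edges, the blue edges contain no
`K^4` and admit no blue threat.  Then the first player has a winning strategy
from this position: each of her moves before the last creates a red threat,
and she completes a red `K^4` within at most 5 further moves of hers. -/
theorem promising_graph_type_six
    (R B : Finset (Sym2 ℕ)) (hdisj : Disjoint R B)
    (a b c d e f g : ℕ)
    (hdist : ({a, b, c, d, e, f, g} : Finset ℕ).card = 7)
    (hab : s(a, b) ∈ R) (hac : s(a, c) ∈ R) (had : s(a, d) ∈ R)
    (hae : s(a, e) ∈ R) (haf : s(a, f) ∈ R) (hag : s(a, g) ∈ R)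
    (hbc : s(b, c) ∈ R)
    (hbd : s(b, d) ∈ B) (hbe : s(b, e) ∈ B) (hbf : s(b, f) ∈ B)
    (hcd : s(c, d) ∈ B) (hce : s(c, e) ∈ B)
    (hbg : s(b, g) ∉ R ∧ s(b, g) ∉ B)
    (hcf : s(c, f) ∉ R ∧ s(c, f) ∉ B)
    (hcg : s(c, g) ∉ R ∧ s(c, g) ∉ B)
    (hde : s(d, e) ∉ R ∧ s(d, e) ∉ B)
    (hdf : s(d, f) ∉ R ∧ s(d, f) ∉ B)
    (hdg : s(d, g) ∉ R ∧ s(d, g) ∉ B)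
    (hef : s(e, f) ∉ R ∧ s(e, f) ∉ B)
    (heg : s(e, g) ∉ R ∧ s(e, g) ∉ B)
    (hfg : s(f, g) ∉ R ∧ s(f, g) ∉ B)
    (hnoblueK4 : ¬ HasK4 (↑B ∪ {s(b, g), s(c, f), s(e, f)}))
    (hnobluethreat : ¬ HasThreat (↑B ∪ {s(b, g), s(c, f), s(e, f)}) ↑R) :
    WinsFromWithinThreats R B 9 := by
  have hnodup : [a, b, c, d, e, f, g].Nodup := by
    rw [← Multiset.coe_nodup, ← Multiset.toFinset_card_eq_card_iff_nodup]
    simpa using hdist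
  have hnodup' : [g, f, e, d, c, b, a].Nodup := List.nodup_reverse.mpr hnodup
  simp only [List.nodup_cons, List.mem_cons, List.not_mem_nil, or_false, not_or] at hnodup hnodup'
  have hcb : s(c, b) ∈ R := Sym2.eq_swap ▸ hbc
  have hsafe : ∀ R' B' : Finset (Sym2 ℕ), R ⊆ R' →
      (B' : Set (Sym2 ℕ)) ⊆ ↑B ∪ {s(b, g), s(c, f), s(e, f)} →
      ∀ y ∉ R', ¬ HasK4 ↑(insert y B') := by
    intro R' B' hR hB y hy
    refine not_hasK4_of_subset_insert hnoblueK4 hnobluethreat (x := y)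
      (fun h => hy (hR (Finset.mem_coe.mp h))) ?_
    rw [Finset.coe_insert]
    exact Set.insert_subset_insert hB
  refine winsFromWithinThreats_of_isThreat (x := s(c, g)) (z := s(b, g)) (by decide)
    (by simp [LegalFrom, *])
    (by apply isThreat_of_edges (p := a) (q := c) (r := b) (s := g) <;> simp [*])
    (hsafe _ _ (by intro; simp +contextual) (by simp +contextual [Set.subset_def])) ?_
  refine winsFromWithinThreats_of_isThreat (x := s(f, g)) (z := s(c, f)) (by decide)
    (by simp [LegalFrom, *])
    (by apply isThreat_of_edges (p := a) (q := g) (r := c) (s := f) <;> simp [*])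
    (hsafe _ _ (by intro; simp +contextual) (by simp +contextual [Set.subset_def])) ?_
  refine winsFromWithinThreats_of_isThreat (x := s(e, g)) (z := s(e, f)) (by decide)
    (by simp [LegalFrom, *])
    (by apply isThreat_of_edges (p := a) (q := g) (r := e) (s := f) <;> simp [*])
    (hsafe _ _ (by intro; simp +contextual) (by simp +contextual [Set.subset_def])) ?_
  exact winsFromWithinThreats_of_isThreat_of_isThreat (x := s(d, g)) (z := s(d, f))
    (z' := s(d, e)) (by simp [LegalFrom, *])
    (by apply isThreat_of_edges (p := a) (q := g) (r := d) (s := f) <;> simp [*])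
    (by apply isThreat_of_edges (p := a) (q := g) (r := d) (s := e) <;> simp [*])
    (by simp [*]) (hsafe _ _ (by intro; simp +contextual) (by simp +contextual [Set.subset_def]))
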